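/- Every nonsignaling bipartite steering assemblage admits a quantum realization (so postquantum common causes give no advantage for steering of quantum states): let d, k, ℓ ≥ 1 and let σ_{a|x} (a ∈ {0,...,k−1}, x ∈ {0,...,ℓ−1}) be positive semidefinite d×d complex matrices such that the matrix ρ := Σ_a σ_{a|x} is the same for all x and Tr(ρ) = 1. Then there exist n ≥ 1, a unit vector ψ ∈ ℂⁿ ⊗ ℂᵈ, and positive semidefinite n×n matrices M_{a|x} with Σ_a M_{a|x} = Iₙ for each x, such that Tr₁[(M_{a|x} ⊗ I_d) ψψ†] = σ_{a|x} for all a and x. -/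

import Mathlib

open Matrix Kronecker ComplexOrder

/-- The partial trace over the first tensor factor:
`Tr₁(M) = Σ_i (⟨e_i| ⊗ I) M (|e_i⟩ ⊗ I)`. -/
noncomputable def ptrace1 {α β : Type*} [Fintype α]
    (M : Matrix (α × β) (α × β) ℂ) : Matrix β β ℂ :=
  Matrix.of fun k l => ∑ i, M (i, k) (i, l)

/-- Diagonalisation data: a square root of `ρ` with a pseudo-inverse. -/
lemma exists_sqrt_data {d : ℕ} (ρ : Matrix (Fin d) (Fin d) ℂ) (h : ρ.PosSemidef) :
    ∃ S T P : Matrix (Fin d) (Fin d) ℂ, S * Sᴴ = ρ ∧ T * ρ * Tᴴ = P ∧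
      (1 - P).PosSemidef ∧ S * (1 - P) = 0 ∧ (1 - S * T) * ρ = 0 := by
  obtain ⟨U, s, hU, hρ⟩ : ∃ (U : Matrix (Fin d) (Fin d) ℂ) (s : Fin d → ℝ),
      Uᴴ * U = 1 ∧ ρ = U * diagonal (fun i => ((s i : ℂ)) * (s i : ℂ)) * Uᴴ := by
    refine ⟨h.1.eigenvectorUnitary, fun i => Real.sqrt (h.1.eigenvalues i), ?_, ?_⟩
    · exact Unitary.coe_star_mul_self _
    · conv_lhs => rw [h.1.spectral_theorem, Unitary.conjStarAlgAut_apply]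
      rw [star_eq_conjTranspose]
      congr 3
      ext i
      simp only [Function.comp]
      rw [← Complex.ofReal_mul, Real.mul_self_sqrt (h.eigenvalues_nonneg i)]
      rfl
  have hst : ∀ (f : Fin d → ℝ), (diagonal (fun i => (f i : ℂ)))ᴴ = diagonal (fun i => (f i : ℂ)) := by
    intro f
    rw [diagonal_conjTranspose]
    congr 1
    ext i
    simp
  have hc : ∀ X : Matrix (Fin d) (Fin d) ℂ, Uᴴ * (U * X) = X := by
    intro X
    rw [← Matrix.mul_assoc, hU, Matrix.one_mul]
  let D : Matrix (Fin d) (Fin d) ℂ := diagonal (fun i => ((s i : ℝ) : ℂ))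
  let E : Matrix (Fin d) (Fin d) ℂ := diagonal (fun i => (((s i)⁻¹ : ℝ) : ℂ))
  have hD : Dᴴ = D := hst s
  have hE : Eᴴ = E := hst (fun i => (s i)⁻¹)
  have hρ' : ρ = U * (D * D) * Uᴴ := by rw [hρ, diagonal_mul_diagonal]
  have hDED : D * (E * D) = D := by
    simp only [D, E, diagonal_mul_diagonal]
    congr 1
    ext i
    by_cases hs : s i = 0
    · simp [hs]
    · have : (s i : ℂ) ≠ 0 := by exact_mod_cast hs
      push_cast
      field_simp
  refine ⟨U * D, E * Uᴴ, (E * D) * (D * E), ?_, ?_, ?_, ?_, ?_⟩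
  · rw [hρ', conjTranspose_mul, hD]; simp only [Matrix.mul_assoc]
  · rw [hρ', conjTranspose_mul, hE, conjTranspose_conjTranspose]
    simp only [Matrix.mul_assoc, hc]
  · have : (1 : Matrix (Fin d) (Fin d) ℂ) - (E * D) * (D * E)
        = diagonal (fun i => if s i = 0 then (1 : ℂ) else 0) := by
      rw [← diagonal_one]
      simp only [D, E, diagonal_mul_diagonal, diagonal_sub]
      congr 1
      ext i
      by_cases hs : s i = 0
      · simp [hs]
      · have : (s i : ℂ) ≠ 0 := by exact_mod_cast hs
        simp [hs]
    rw [this]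
    apply PosSemidef.diagonal
    intro i
    by_cases hs : s i = 0 <;> simp [hs]
  · have hED : E * D = D * E := by
      simp only [D, E, diagonal_mul_diagonal]
      congr 1
      ext i
      ring
    have : U * D * (E * D * (D * E)) = U * (D * (E * D) * (E * D)) := by
      rw [← hED]; simp only [Matrix.mul_assoc]
    rw [Matrix.mul_sub, this, hDED, hDED, Matrix.mul_one, sub_self]
  · have : U * D * (E * Uᴴ) * ρ = U * (D * (E * D) * D) * Uᴴ := by
      rw [hρ']; simp only [Matrix.mul_assoc, hc]
    rw [Matrix.sub_mul, this, hDED, hρ', Matrix.one_mul, sub_self]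

/-- If a positive semidefinite sum is killed by `A`, so is every summand. -/
lemma mul_eq_zero_of_sum {d k : ℕ} (σ : Fin k → Matrix (Fin d) (Fin d) ℂ)
    (hpsd : ∀ a, (σ a).PosSemidef) (A : Matrix (Fin d) (Fin d) ℂ)
    (hA : A * (∑ a, σ a) = 0) (a : Fin k) : A * σ a = 0 := by
  have hp : ∀ b, (A * σ b * Aᴴ).PosSemidef := fun b => (hpsd b).mul_mul_conjTranspose_same A
  have hs : ∑ b, (A * σ b * Aᴴ).trace = 0 := by
    rw [← trace_sum, ← Finset.sum_mul, ← Finset.mul_sum, hA, Matrix.zero_mul, trace_zero]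
  have h0 := (Finset.sum_eq_zero_iff_of_nonneg (fun b _ => (hp b).trace_nonneg)).1 hs a
    (Finset.mem_univ a)
  rw [(hp a).trace_eq_zero_iff] at h0
  obtain ⟨B, -, -, hB, -⟩ := exists_sqrt_data (σ a) (hpsd a)
  have h1 : (A * B) * (A * B)ᴴ = 0 := by
    rw [← h0, ← hB]
    simp only [conjTranspose_mul, conjTranspose_conjTranspose, Matrix.mul_assoc]
  rw [self_mul_conjTranspose_eq_zero] at h1
  rw [← hB, ← Matrix.mul_assoc, h1, Matrix.zero_mul]

lemma ptrace1_formula {d : ℕ} (S N : Matrix (Fin d) (Fin d) ℂ) :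
    ptrace1 ((Nᵀ ⊗ₖ (1 : Matrix (Fin d) (Fin d) ℂ)) *
      Matrix.vecMulVec (fun p : Fin d × Fin d => S p.2 p.1)
        (star (fun p : Fin d × Fin d => S p.2 p.1))) = S * N * Sᴴ := by
  ext k l
  simp only [ptrace1, of_apply, Matrix.mul_apply, kroneckerMap_apply, vecMulVec_apply,
    Fintype.sum_prod_type, one_apply, transpose_apply, conjTranspose_apply, Pi.star_apply,
    mul_ite, mul_one, mul_zero, ite_mul, zero_mul, Finset.sum_ite_eq, Finset.mem_univ, if_true,
    Finset.sum_mul]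
  refine Finset.sum_congr rfl fun i _ => Finset.sum_congr rfl fun j _ => ?_
  ring

/-- every nonsignaling bipartite steering assemblage `{σ_{a|x}}` (positive
semidefinite d×d matrices with `Σ_a σ_{a|x} = ρ` independent of `x` and `Tr ρ = 1`) admits a
quantum realization: there are `n ≥ 1`, a unit vector `ψ ∈ ℂⁿ ⊗ ℂᵈ`, and POVMs
`{M_{a|x}}` on `ℂⁿ` with `Tr₁[(M_{a|x} ⊗ I_d) ψψ†] = σ_{a|x}` for all `a, x`. -/
theorem stmt_10 (d k ℓ : ℕ) (hd : 1 ≤ d) (hk : 1 ≤ k) (hℓ : 1 ≤ ℓ)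
    (σ : Fin k → Fin ℓ → Matrix (Fin d) (Fin d) ℂ)
    (hpsd : ∀ a x, (σ a x).PosSemidef)
    (ρ : Matrix (Fin d) (Fin d) ℂ)
    (hsum : ∀ x, ∑ a, σ a x = ρ) (htr : ρ.trace = 1) :
    ∃ n : ℕ, 1 ≤ n ∧
      ∃ ψ : Fin n × Fin d → ℂ, star ψ ⬝ᵥ ψ = 1 ∧
        ∃ M : Fin k → Fin ℓ → Matrix (Fin n) (Fin n) ℂ,
          (∀ a x, (M a x).PosSemidef) ∧ (∀ x, ∑ a, M a x = 1) ∧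
          ∀ a x,
            ptrace1 ((M a x ⊗ₖ (1 : Matrix (Fin d) (Fin d) ℂ)) *
              Matrix.vecMulVec ψ (star ψ)) = σ a x := by
  obtain ⟨S, T, P, hS, hT, hP, hSP, hST⟩ := exists_sqrt_data ρ (by
    rw [← hsum ⟨0, hℓ⟩]
    exact Matrix.posSemidef_sum _ fun a _ => hpsd a _)
  let N : Fin k → Fin ℓ → Matrix (Fin d) (Fin d) ℂ := fun a x =>
    T * σ a x * Tᴴ + if a = ⟨0, hk⟩ then 1 - P else 0
  refine ⟨d, hd, fun p => S p.2 p.1, ?_, fun a x => (N a x)ᵀ, ?_, ?_, ?_⟩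
  · rw [← htr, ← hS]
    simp only [dotProduct, Fintype.sum_prod_type, trace, diag_apply, Matrix.mul_apply,
      conjTranspose_apply, Pi.star_apply]
    rw [Finset.sum_comm]
    refine Finset.sum_congr rfl fun i _ => Finset.sum_congr rfl fun j _ => ?_
    ring
  · intro a x
    refine PosSemidef.transpose (PosSemidef.add ((hpsd a x).mul_mul_conjTranspose_same T) ?_)
    split_ifs
    · exact hP
    · exact PosSemidef.zero
  · intro x
    rw [← transpose_sum]
    simp only [N]
    rw [Finset.sum_add_distrib, ← Finset.sum_mul, ← Finset.mul_sum, hsum, hT]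
    simp
  · intro a x
    rw [ptrace1_formula]
    have h1 : (1 - S * T) * σ a x = 0 :=
      mul_eq_zero_of_sum (fun a => σ a x) (fun a => hpsd a x) _ (by rw [hsum, hST]) a
    rw [Matrix.sub_mul, Matrix.one_mul, sub_eq_zero] at h1
    have h2 : σ a x = σ a x * (S * T)ᴴ := by
      have := congrArg conjTranspose h1
      rwa [conjTranspose_mul, (hpsd a x).1.eq] at this
    have h3 : S * (if a = ⟨0, hk⟩ then 1 - P else 0) = 0 := by
      split_ifs
      · exact hSP
      · exact Matrix.mul_zero _
    simp only [N]
    rw [Matrix.mul_add, h3, add_zero]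
    calc S * (T * σ a x * Tᴴ) * Sᴴ = (S * T * σ a x) * (S * T)ᴴ := by
          rw [conjTranspose_mul]; simp only [Matrix.mul_assoc]
      _ = σ a x := by rw [← h1, ← h2]
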